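/- arXiv:1504.04487 — 3 statements merged into one kernel-verified Lean document; each statement's English description precedes it below -/
import Mathlib

section
/- Let $I = (p', s')$ be an open interval of $\mathbb{R}$ and let $p, q, s \in I$ with $p' < p < q < s < s'$. Suppose that $d_I(p) = |p - p'|$, $d_I(s) = |s - s'|$ and $d_I(q) = |p - q| + |p - p'|$, where $d_I(u) = \min\{|u - p'|, |u - s'|\}$. Then the triangle inequality $h_I(p,s) \leq h_I(p,q) + h_I(q,s)$ holds, where $h_I(u,v) = \log\left(1 + 2|u-v|/\sqrt{d_I(u)d_I(v)}\right)$. -/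
/-- The function `h_I` of an open interval `I = (p', s') ⊂ ℝ`, with
`d_I(u) = min{|u - p'|, |u - s'|}`. -/
noncomputable def hInterval (p' s' u v : ℝ) : ℝ :=
  Real.log (1 + 2 * |u - v| /
    Real.sqrt (min |u - p'| |u - s'| * min |v - p'| |v - s'|))

/-- Let `p' < p < q < s < s'` with `d_I(p) = |p - p'|`, `d_I(s) = |s - s'|` and
`d_I(q) = |p - q| + |p - p'|`. Then `h_I(p,s) ≤ h_I(p,q) + h_I(q,s)`. -/
theorem hInterval_triangle (p' s' p q s : ℝ)
    (h1 : p' < p) (h2 : p < q) (h3 : q < s) (h4 : s < s')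
    (hdp : min |p - p'| |p - s'| = |p - p'|)
    (hds : min |s - p'| |s - s'| = |s - s'|)
    (hdq : min |q - p'| |q - s'| = |p - q| + |p - p'|) :
    hInterval p' s' p s ≤ hInterval p' s' p q + hInterval p' s' q s := by
  rw [abs_of_pos (sub_pos.2 h1)] at hdp hdq
  rw [abs_of_neg (sub_neg.2 h4)] at hds
  rw [abs_of_neg (sub_neg.2 h2)] at hdq
  have hq : q - p' ≤ s' - q := by
    have h := min_le_right |q - p'| |q - s'|
    rw [hdq, abs_of_neg (by linarith : q - s' < 0)] at h
    linarith
  have hdq' : min |q - p'| |q - s'| = q - p' := by rw [hdq]; ring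
  have hdp' : min |p - p'| |p - s'| = p - p' := by
    rw [abs_of_pos (sub_pos.2 h1)]; exact hdp
  have hds' : min |s - p'| |s - s'| = s' - s := by
    rw [abs_of_neg (sub_neg.2 h4), hds]; ring
  unfold hInterval
  rw [hdp', hdq', hds', abs_of_neg (by linarith : p - s < 0),
    abs_of_neg (by linarith : p - q < 0), abs_of_neg (by linarith : q - s < 0),
    Real.sqrt_mul (by linarith), Real.sqrt_mul (by linarith), Real.sqrt_mul (by linarith)]
  have ha : 0 < √(p - p') := Real.sqrt_pos.2 (by linarith)
  have hb : 0 < √(q - p') := Real.sqrt_pos.2 (by linarith)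
  have hc : 0 < √(s' - s) := Real.sqrt_pos.2 (by linarith)
  have hab : √(p - p') < √(q - p') := Real.sqrt_lt_sqrt (by linarith) (by linarith)
  have ea : √(p - p') ^ 2 = p - p' := Real.sq_sqrt (by linarith)
  have eb : √(q - p') ^ 2 = q - p' := Real.sq_sqrt (by linarith)
  have ec : √(s' - s) ^ 2 = s' - s := Real.sq_sqrt (by linarith)
  generalize √(p - p') = a at *
  generalize √(q - p') = b at *
  generalize √(s' - s) = c at *
  obtain ⟨y, hy⟩ : ∃ y, y = s - q := ⟨_, rfl⟩
  have e1 : -(p - s) = (b ^ 2 - a ^ 2) + y := by linarith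
  have e2 : -(p - q) = b ^ 2 - a ^ 2 := by linarith
  have e3 : -(q - s) = y := by linarith
  have hy0 : 0 < y := by linarith
  have hyb : b ^ 2 - c ^ 2 ≤ y := by linarith
  have hx0 : 0 < b ^ 2 - a ^ 2 := by linarith
  rw [e1, e2, e3]
  rw [← Real.log_mul (by positivity) (by positivity)]
  apply Real.log_le_log (by positivity)
  have key : b * (b + a) * (b - c) ≤ y * (b + 2 * a) := by
    rcases le_total b c with h | h
    · have : b * (b + a) * (b - c) ≤ 0 :=
        mul_nonpos_of_nonneg_of_nonpos (by positivity) (by linarith)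
      have : 0 ≤ y * (b + 2 * a) := by positivity
      linarith
    · have t1 : (b ^ 2 - c ^ 2) * (b + 2 * a) ≤ y * (b + 2 * a) :=
        mul_le_mul_of_nonneg_right hyb (by positivity)
      have t2 : 0 ≤ (b - c) * (a * b + b * c + 2 * a * c) :=
        mul_nonneg (by linarith) (by positivity)
      nlinarith
  have key2 := mul_le_mul_of_nonneg_left key (by linarith : 0 ≤ b - a)
  have e : (1 + 2 * (b ^ 2 - a ^ 2) / (a * b)) * (1 + 2 * y / (b * c))
      - (1 + 2 * (b ^ 2 - a ^ 2 + y) / (a * c))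
      = 2 * ((b - a) * (y * (b + 2 * a)) - (b - a) * (b * (b + a) * (b - c))) /
        (a * b ^ 2 * c) := by
    field_simp
    ring
  have : 0 ≤ 2 * ((b - a) * (y * (b + 2 * a)) - (b - a) * (b * (b + a) * (b - c))) /
        (a * b ^ 2 * c) := div_nonneg (by linarith) (by positivity)
  linarith
end

section
/- Let $D$ be a nonempty open set in a metric space $(X, \rho)$, let $A$ be a nonempty subset of $X \setminus D$, and let $c \geq 2$. Then the function $h(x,y) = \log\left(1 + c\,\rho(x,y)/\sqrt{d_{D,A}(x)\, d_{D,A}(y)}\right)$ satisfies the triangle inequality $h(x,y) \leq h(x,z) + h(z,y)$ for all $x, y, z \in D$. -/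
/-- The function `h(x,y) = log(1 + c ρ(x,y)/√(d_{D,A}(x) d_{D,A}(y)))`, where
`d_{D,A}(x) = dist(x, A)` for a set `A ⊆ X \ D`. -/
noncomputable def hRel {X : Type*} [MetricSpace X] (A : Set X) (c : ℝ) (x y : X) : ℝ :=
  Real.log (1 + c * dist x y /
    Real.sqrt (Metric.infDist x A * Metric.infDist y A))

/-- Let `D` be a nonempty open set in a metric space `(X, ρ)`, let `A` be a nonempty
subset of `X \ D`, and let `c ≥ 2`. Then `h(x,y) = log(1 + c ρ(x,y)/√(d_{D,A}(x) d_{D,A}(y)))`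
satisfies the triangle inequality on `D`. -/
theorem hRel_triangle {X : Type*} [MetricSpace X] (D A : Set X)
    (hD : IsOpen D) (hne : D.Nonempty) (hA : A.Nonempty) (hAD : A ⊆ Dᶜ)
    (c : ℝ) (hc : 2 ≤ c) :
    ∀ x ∈ D, ∀ y ∈ D, ∀ z ∈ D,
      hRel A c x y ≤ hRel A c x z + hRel A c z y := by
  intro x hx y hy z hz
  have pos : ∀ w ∈ D, 0 < Metric.infDist w A := by
    intro w hw
    have h1 : w ∉ closure A := by
      intro h
      have := (closure_minimal hAD hD.isClosed_compl) h
      exact this hw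
    have h2 : Metric.infDist w A ≠ 0 := fun h => h1 ((Metric.mem_closure_iff_infDist_zero hA).2 h)
    exact lt_of_le_of_ne Metric.infDist_nonneg (Ne.symm h2)
  have key : ∀ t b q : ℝ, 0 < t → 0 < b → 0 ≤ q → t ^ 2 ≤ b ^ 2 + q → t * (t - b) ≤ q := by
    intro t b q ht hb hq h
    rcases le_total t b with h1 | h1 <;> nlinarith
  have dx := pos x hx
  have dy := pos y hy
  have dz := pos z hz
  have lzx : Metric.infDist z A ≤ Metric.infDist x A + dist x z := by
    rw [dist_comm]; exact Metric.infDist_le_infDist_add_dist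
  have lzy : Metric.infDist z A ≤ Metric.infDist y A + dist z y :=
    Metric.infDist_le_infDist_add_dist
  have tri := dist_triangle x z y
  have hp : 0 ≤ dist x z := dist_nonneg
  have hq : 0 ≤ dist z y := dist_nonneg
  have hr : 0 ≤ dist x y := dist_nonneg
  unfold hRel
  rw [Real.sqrt_mul dx.le, Real.sqrt_mul dx.le, Real.sqrt_mul dz.le]
  have sx := Real.sq_sqrt dx.le
  have sy := Real.sq_sqrt dy.le
  have sz := Real.sq_sqrt dz.le
  have ha := Real.sqrt_pos.2 dx
  have hb := Real.sqrt_pos.2 dy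
  have ht := Real.sqrt_pos.2 dz
  rw [← sz, ← sx] at lzx
  rw [← sz, ← sy] at lzy
  clear sx sy sz
  generalize √(Metric.infDist x A) = a at *
  generalize √(Metric.infDist y A) = b at *
  generalize √(Metric.infDist z A) = t at *
  generalize dist x z = p at *
  generalize dist z y = q at *
  generalize dist x y = r at *
  have k1 := mul_le_mul_of_nonneg_left (key t b q ht hb hq lzy) hp
  have k2 := mul_le_mul_of_nonneg_left (key t a p ht ha hp lzx) hq
  have hc0 : 0 < c := by linarith
  have hpq : 0 ≤ p * q := mul_nonneg hp hq
  have main : (p + q) * t ^ 2 ≤ p * t * b + q * t * a + c * p * q := by nlinarith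
  have main2 : r * t ^ 2 ≤ p * t * b + q * t * a + c * p * q :=
    (mul_le_mul_of_nonneg_right tri (sq_nonneg t)).trans main
  rw [← Real.log_mul (by positivity) (by positivity)]
  apply Real.log_le_log (by positivity)
  have e : (1 + c * p / (a * t)) * (1 + c * q / (t * b)) - (1 + c * r / (a * b))
      = c * (p * t * b + q * t * a + c * p * q - r * t ^ 2) / (a * b * t ^ 2) := by
    field_simp
    ring
  have : 0 ≤ c * (p * t * b + q * t * a + c * p * q - r * t ^ 2) / (a * b * t ^ 2) := by
    apply div_nonneg (mul_nonneg hc0.le (by linarith)) (by positivity)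
  linarith
end

section
/- Let $c > 0$ and let $f : G \to G'$ be a homeomorphism between nonempty proper open subsets $G, G' \subset \mathbb{R}^n$ with $f(G) = G'$. Suppose there exists $L \geq 1$ such that $h_{G,c}(x,y)/L \leq h_{G',c}(f(x), f(y)) \leq L\, h_{G,c}(x,y)$ for all $x, y \in G$. Then for every $z \in G$ the linear dilatation satisfies $H(f,z) = \limsup_{r \to 0^+} \sup\left\{\frac{|f(x)-f(z)|}{|f(y)-f(z)|} : |x-z| = |y-z| = r\right\} \leq L^2$. -/
/-- The metric `h_{D,c}` of a proper open subset `D ⊂ ℝⁿ`,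
with `d(x) = dist(x, ∂D)`. -/
noncomputable def hMetric {n : ℕ} (D : Set (EuclideanSpace ℝ (Fin n))) (c : ℝ)
    (x y : EuclideanSpace ℝ (Fin n)) : ℝ :=
  Real.log (1 + c * ‖x - y‖ /
    Real.sqrt (Metric.infDist x (frontier D) * Metric.infDist y (frontier D)))

open Filter Topology

lemma infDist_frontier_pos' {n : ℕ} {D : Set (EuclideanSpace ℝ (Fin n))} (ho : IsOpen D)
    (hp : D ≠ Set.univ) {z : EuclideanSpace ℝ (Fin n)} (hz : z ∈ D) :
    0 < Metric.infDist z (frontier D) := by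
  have hne : (frontier D).Nonempty := nonempty_frontier_iff.2 ⟨⟨z, hz⟩, hp⟩
  rw [← isClosed_frontier.notMem_iff_infDist_pos hne, ho.frontier_eq]
  exact fun h => h.2 hz

lemma hMetric_tendsto {n : ℕ} {D : Set (EuclideanSpace ℝ (Fin n))} (ho : IsOpen D)
    (hp : D ≠ Set.univ) {z : EuclideanSpace ℝ (Fin n)} (hz : z ∈ D) (c : ℝ) (hc : 0 < c) :
    Tendsto (fun x => hMetric D c x z / dist x z) (𝓝[≠] z)
      (𝓝 (c / Metric.infDist z (frontier D))) := by
  have hd := infDist_frontier_pos' ho hp hz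
  set δ := Metric.infDist z (frontier D) with hδ
  have hs : Tendsto (fun x => c / Real.sqrt (Metric.infDist x (frontier D) * δ)) (𝓝[≠] z)
      (𝓝 (c / δ)) := by
    have h1 : ContinuousAt (fun x => c / Real.sqrt (Metric.infDist x (frontier D) * δ)) z := by
      refine ContinuousAt.div continuousAt_const ?_ ?_
      · exact (((Metric.continuous_infDist_pt _).mul continuous_const).sqrt).continuousAt
      · exact (Real.sqrt_pos.2 (mul_pos hd hd)).ne'
    have h2 := h1.tendsto.mono_left (nhdsWithin_le_nhds (s := {z}ᶜ))
    simpa only [← hδ, Real.sqrt_mul_self hd.le] using h2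
  have hu : Tendsto (fun x => dist x z * (c / Real.sqrt (Metric.infDist x (frontier D) * δ)))
      (𝓝[≠] z) (𝓝 0) := by
    have h1 : Tendsto (fun x => dist x z) (𝓝[≠] z) (𝓝 0) := by
      have : ContinuousAt (fun x => dist x z) z := by fun_prop
      simpa using this.tendsto.mono_left (nhdsWithin_le_nhds (s := {z}ᶜ))
    simpa using h1.mul hs
  have hpos : ∀ᶠ x in 𝓝[≠] z, 0 < c / Real.sqrt (Metric.infDist x (frontier D) * δ) :=
    hs.eventually (lt_mem_nhds (div_pos hc hd))
  have hne : ∀ᶠ x in 𝓝[≠] z, x ≠ z := self_mem_nhdsWithin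
  have hlog : Tendsto (fun u : ℝ => Real.log (1 + u) / u) (𝓝[≠] 0) (𝓝 1) := by
    have h := (Real.hasDerivAt_log (one_ne_zero)).tendsto_slope_zero
    simpa [div_eq_inv_mul] using h
  have hu' := hlog.comp (tendsto_nhdsWithin_iff.2 ⟨hu, by
    filter_upwards [hpos, hne] with x h1 h2
    exact (mul_pos (dist_pos.2 h2) h1).ne'⟩)
  have := hu'.mul hs
  rw [one_mul] at this
  refine this.congr' ?_
  filter_upwards [hpos, hne] with x h1 h2
  have h3 := dist_pos.2 h2
  simp only [Function.comp, hMetric, ← dist_eq_norm, ← hδ]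
  have : c * dist x z / Real.sqrt (Metric.infDist x (frontier D) * δ) =
    dist x z * (c / Real.sqrt (Metric.infDist x (frontier D) * δ)) := by ring
  rw [this]
  generalize c / Real.sqrt (Metric.infDist x (frontier D) * δ) = a at *
  field_simp

/-- If `f : G → G'` is a homeomorphism between proper open subsets of `ℝⁿ` which is
`L`-bilipschitz with respect to the `h_{·,c}`-metrics, then at every `z ∈ G` the
linear dilatation `H(f,z)` is at most `L²`. -/
theorem linear_dilatation_le_of_hMetric_bilipschitz {n : ℕ}
    (G G' : Set (EuclideanSpace ℝ (Fin n)))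
    (hGo : IsOpen G) (hGne : G.Nonempty) (hGp : G ≠ Set.univ)
    (hG'o : IsOpen G') (hG'ne : G'.Nonempty) (hG'p : G' ≠ Set.univ)
    (f : EuclideanSpace ℝ (Fin n) → EuclideanSpace ℝ (Fin n))
    (himg : f '' G = G')
    (hhomeo : ∃ e : G ≃ₜ G', ∀ x : G, (e x : EuclideanSpace ℝ (Fin n)) = f x)
    (c : ℝ) (hc : 0 < c) (L : ℝ) (hL : 1 ≤ L)
    (hbl : ∀ x ∈ G, ∀ y ∈ G,
      hMetric G c x y / L ≤ hMetric G' c (f x) (f y) ∧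
        hMetric G' c (f x) (f y) ≤ L * hMetric G c x y) :
    ∀ z ∈ G,
      Filter.limsup (fun r : ℝ =>
          sSup {t : ℝ | ∃ x ∈ G, ∃ y ∈ G, dist x z = r ∧ dist y z = r ∧
            t = dist (f x) (f z) / dist (f y) (f z)})
        (nhdsWithin 0 (Set.Ioi 0)) ≤ L ^ 2 := by
  intro z hz
  have hcont : ContinuousAt f z := by
    obtain ⟨e, he⟩ := hhomeo
    have : ContinuousOn f G := by
      rw [continuousOn_iff_continuous_domRestrict]
      have h2 : G.domRestrict f = fun x => (e x : EuclideanSpace ℝ (Fin n)) := by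
        ext1 x; exact (he x).symm
      rw [h2]
      exact continuous_subtype_val.comp e.continuous
    exact this.continuousAt (hGo.mem_nhds hz)
  have hinj : ∀ x ∈ G, x ≠ z → f x ≠ f z := by
    obtain ⟨e, he⟩ := hhomeo
    intro x hx hxz h
    apply hxz
    have : e ⟨x, hx⟩ = e ⟨z, hz⟩ := by
      apply Subtype.ext
      rw [he, he]; exact h
    simpa using e.injective this
  have hfz : f z ∈ G' := himg ▸ Set.mem_image_of_mem f hz
  have hd := infDist_frontier_pos' hGo hGp hz
  have hd' := infDist_frontier_pos' hG'o hG'p hfz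
  have hG : ∀ᶠ x in 𝓝[≠] z, x ∈ G := nhdsWithin_le_nhds (hGo.mem_nhds hz)
  have hne : ∀ᶠ x in 𝓝[≠] z, x ≠ z := self_mem_nhdsWithin
  have t1 := hMetric_tendsto hGo hGp hz c hc
  have hf : Tendsto f (𝓝[≠] z) (𝓝[≠] (f z)) := by
    refine tendsto_nhdsWithin_iff.2 ⟨hcont.tendsto.mono_left nhdsWithin_le_nhds, ?_⟩
    filter_upwards [hG, hne] with x h1 h2
    exact hinj x h1 h2
  have t2 := (hMetric_tendsto hG'o hG'p hfz c hc).comp hf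
  have p1 := div_pos hc hd
  have p2 := div_pos hc hd'
  have t3 := t1.div t2 p2.ne'
  have pA := div_pos p1 p2
  generalize (c / Metric.infDist z (frontier G)) / (c / Metric.infDist (f z) (frontier G')) = A at *
  have hL0 : 0 < L := by linarith
  refine le_of_forall_gt_imp_ge_of_dense fun K hK => ?_
  have hK0 : 0 < K := lt_trans (by positivity) hK
  obtain ⟨s, hs1, hsK⟩ : ∃ s : ℝ, 1 < s ∧ L ^ 2 * s ^ 2 = K := by
    refine ⟨Real.sqrt (K / L ^ 2), ?_, ?_⟩
    · rw [Real.lt_sqrt (by norm_num), lt_div_iff₀ (by positivity)]; linarith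
    · rw [Real.sq_sqrt (by positivity)]; field_simp
  have hs0 : 0 < s := by linarith
  have e1 := t3.eventually (gt_mem_nhds (show A < A * s by nlinarith))
  have e2 := t3.eventually (lt_mem_nhds (show A / s < A by
    rw [div_lt_iff₀ hs0]; nlinarith))
  have key : ∀ᶠ x in 𝓝[≠] z, dist (f x) (f z) ≤ L * (A * s) * dist x z ∧
      A / s / L * dist x z ≤ dist (f x) (f z) := by
    filter_upwards [e1, e2, hG, hne, t1.eventually (lt_mem_nhds p1),
      t2.eventually (lt_mem_nhds p2)] with x h1 h2 hx hxz q1 q2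
    have r1 := dist_pos.2 hxz
    have r2 := dist_pos.2 (hinj x hx hxz)
    obtain ⟨b1, b2⟩ := hbl x hx z hz
    simp only [Function.comp, Pi.div_apply] at h1 h2 q1 q2
    generalize hMetric G c x z = h at *
    generalize hMetric G' c (f x) (f z) = h' at *
    generalize dist x z = r at *
    generalize dist (f x) (f z) = r' at *
    have hh : 0 < h := by
      have := mul_pos q1 r1
      rwa [div_mul_cancel₀ _ r1.ne'] at this
    have hh' : 0 < h' := by
      have := mul_pos q2 r2
      rwa [div_mul_cancel₀ _ r2.ne'] at this
    have e : r' = (h' / h) * (h / r / (h' / r')) * r := by field_simp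
    have c1 : h' / h ≤ L := by rwa [div_le_iff₀ hh]
    have c2 : 1 / L ≤ h' / h := by
      rw [div_le_div_iff₀ hL0 hh]; rw [div_le_iff₀ hL0] at b1; linarith
    have hr : 0 < h' / h := by positivity
    generalize h' / h = ρ at *
    generalize h / r / (h' / r') = τ at *
    have hAs : 0 < A / s := by positivity
    have hτ : 0 ≤ τ := by linarith
    rw [e]
    constructor
    · gcongr
    · have : A / s / L = 1 / L * (A / s) := by ring
      rw [this]
      gcongr
  rw [eventually_nhdsWithin_iff, Metric.eventually_nhds_iff] at key
  obtain ⟨ε, hε, key⟩ := key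
  refine limsup_le_of_le ?_ ?_
  · refine isCoboundedUnder_le_of_le _ (x := 0) fun r => ?_
    refine Real.sSup_nonneg ?_
    rintro t ⟨x, -, y, -, -, -, rfl⟩
    positivity
  · filter_upwards [Ioo_mem_nhdsGT hε] with r hr
    refine Real.sSup_le ?_ hK0.le
    rintro t ⟨x, hx, y, hy, hxr, hyr, rfl⟩
    have k1 := (key (y := x) (hxr ▸ hr.2) (dist_pos.1 (hxr ▸ hr.1))).1
    have k2 := (key (y := y) (hyr ▸ hr.2) (dist_pos.1 (hyr ▸ hr.1))).2
    rw [hxr] at k1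
    rw [hyr] at k2
    have hr0 : 0 < r := hr.1
    have hpos : 0 < A / s / L * r := by positivity
    rw [div_le_iff₀ (hpos.trans_le k2)]
    calc _ ≤ _ := k1
      _ = K * (A / s / L * r) := by rw [← hsK]; field_simp
      _ ≤ _ := by gcongr
end
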